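/- Fix α > 0, λ ∈ (0,1], and n ∈ ℕ, and let d_α(n) = d_α(p_{n;λ}, q_λ) be the factorial moment distance of order α between the generalized matching pmf and the Poisson(λ) pmf. Then d_α(n) = (1/α) ∑_{k=n+1}^∞ (αλ)^k/k! = (α^n λ^{n+1}/n!) ∫_0^1 (1−y)^n e^{αλy} dy. -/

import Mathlib

open scoped BigOperators ENNReal

/-- A probability mass function on ℕ. -/
def IsPmf (p : ℕ → ℝ) : Prop := (∀ j, 0 ≤ p j) ∧ ∑' j, p j = 1

/-- Total variation distance between two pmfs on ℕ. -/
noncomputable def dtv (p q : ℕ → ℝ) : ℝ := (1 / 2) * ∑' j, |p j - q j|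

/-- Descending factorial (j)_k = j(j-1)⋯(j-k+1), as a real number. -/
noncomputable def descFac (j k : ℕ) : ℝ := ∏ i ∈ Finset.range k, ((j : ℝ) - i)

/-- k-th descending factorial moment of a pmf p. -/
noncomputable def facMoment (k : ℕ) (p : ℕ → ℝ) : ℝ := ∑' j, descFac j k * p j

/-- Factorial moment distance of order α, with values in [0,∞]:
    d_α(p,q) = ∑_{k=1}^∞ (α^{k-1}/k!) |M_k(p) - M_k(q)|. -/
noncomputable def dFM (α : ℝ) (p q : ℕ → ℝ) : ℝ≥0∞ :=
  ∑' k : ℕ, ENNReal.ofReal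
    (α ^ k / (Nat.factorial (k + 1) : ℝ) * |facMoment (k + 1) p - facMoment (k + 1) q|)

/-- The Poisson(λ) pmf. -/
noncomputable def poissonPmf (lam : ℝ) (j : ℕ) : ℝ :=
  Real.exp (-lam) * lam ^ j / (Nat.factorial j : ℝ)

/-- The generalized matching pmf p_{n;λ}. -/
noncomputable def genMatch (n : ℕ) (lam : ℝ) (j : ℕ) : ℝ :=
  if j ≤ n then
    lam ^ j / (Nat.factorial j : ℝ) * ∑ i ∈ Finset.range (n - j + 1), (-lam) ^ i / (Nat.factorial i : ℝ)
  else 0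

theorem descFac_of_lt {j k : ℕ} (h : j < k) : descFac j k = 0 :=
  Finset.prod_eq_zero (Finset.mem_range.2 h) (sub_self _)

theorem descFac_add_mul_factorial (m k : ℕ) :
    descFac (m + k) k * (m.factorial : ℝ) = ((m + k).factorial : ℝ) := by
  induction k with
  | zero => simp [descFac]
  | succ k ih =>
    have h : descFac (m + (k + 1)) (k + 1) = ((m + k : ℕ) + 1 : ℝ) * descFac (m + k) k := by
      unfold descFac
      rw [Finset.prod_range_succ', mul_comm]
      push_cast
      congr 1
      · ring
      · exact Finset.prod_congr rfl fun i _ => by ring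
    rw [h, mul_assoc, ih, ← add_assoc, Nat.factorial_succ]
    push_cast
    ring

theorem descFac_add_div_factorial (m k : ℕ) :
    descFac (m + k) k / ((m + k).factorial : ℝ) = 1 / (m.factorial : ℝ) := by
  have h := descFac_add_mul_factorial m k
  field_simp
  linarith

theorem tsum_eq_tsum_add_of_lt_eq_zero {M : Type*} [AddCommMonoid M] [TopologicalSpace M]
    {f : ℕ → M} (k : ℕ) (hf : ∀ j < k, f j = 0) : ∑' j, f j = ∑' m, f (m + k) := by
  refine ((add_left_injective k).tsum_eq fun j hj => ?_).symm
  exact ⟨j - k, Nat.sub_add_cancel (not_lt.1 fun h => hj (hf j h))⟩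

theorem facMoment_eq_tsum_add (k : ℕ) (p : ℕ → ℝ) :
    facMoment k p = ∑' m, descFac (m + k) k * p (m + k) :=
  tsum_eq_tsum_add_of_lt_eq_zero k fun j hj => by rw [descFac_of_lt hj, zero_mul]

theorem facMoment_poissonPmf (k : ℕ) (lam : ℝ) : facMoment k (poissonPmf lam) = lam ^ k := by
  have h (m : ℕ) : descFac (m + k) k * poissonPmf lam (m + k) =
      Real.exp (-lam) * lam ^ k * (lam ^ m / (m.factorial : ℝ)) := by
    calc _ = Real.exp (-lam) * lam ^ (m + k) * (descFac (m + k) k / ((m + k).factorial : ℝ)) := by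
          rw [poissonPmf]; ring
      _ = _ := by rw [descFac_add_div_factorial]; ring
  have hexp : ∑' m : ℕ, lam ^ m / (m.factorial : ℝ) = Real.exp lam := by
    rw [Real.exp_eq_exp_ℝ, NormedSpace.exp_eq_tsum_div]
  rw [facMoment_eq_tsum_add, tsum_congr h, tsum_mul_left, hexp, mul_right_comm, ← Real.exp_add]
  simp

theorem sum_range_pow_div_factorial_mul_neg (lam : ℝ) (N : ℕ) :
    ∑ m ∈ Finset.range (N + 1), lam ^ m / (m.factorial : ℝ) *
      ((-lam) ^ (N - m) / ((N - m).factorial : ℝ)) = if N = 0 then 1 else 0 := by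
  have h : ∑ m ∈ Finset.range (N + 1), lam ^ m / (m.factorial : ℝ) *
      ((-lam) ^ (N - m) / ((N - m).factorial : ℝ)) = (lam + -lam) ^ N / (N.factorial : ℝ) := by
    rw [add_pow, Finset.sum_div]
    refine Finset.sum_congr rfl fun m hm => ?_
    rw [Nat.cast_choose ℝ (Nat.lt_succ_iff.1 (Finset.mem_range.1 hm))]
    field_simp
  rw [h, add_neg_cancel]
  split_ifs with hN <;> simp [hN]

theorem sum_range_pow_div_factorial_mul_sum_neg (lam : ℝ) (N : ℕ) :
    ∑ m ∈ Finset.range (N + 1), lam ^ m / (m.factorial : ℝ) *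
      ∑ i ∈ Finset.range (N - m + 1), (-lam) ^ i / (i.factorial : ℝ) = 1 := by
  induction N with
  | zero => simp
  | succ N ih =>
    have hlast := sum_range_pow_div_factorial_mul_neg lam (N + 1)
    rw [if_neg N.succ_ne_zero, Finset.sum_range_succ] at hlast
    rw [Finset.sum_range_succ]
    have hsplit : ∀ m ∈ Finset.range (N + 1), lam ^ m / (m.factorial : ℝ) *
        ∑ i ∈ Finset.range (N + 1 - m + 1), (-lam) ^ i / (i.factorial : ℝ) =
        lam ^ m / (m.factorial : ℝ) *
          ∑ i ∈ Finset.range (N - m + 1), (-lam) ^ i / (i.factorial : ℝ) +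
        lam ^ m / (m.factorial : ℝ) *
          ((-lam) ^ (N + 1 - m) / ((N + 1 - m).factorial : ℝ)) := fun m hm => by
      rw [Finset.sum_range_succ, mul_add,
        Nat.succ_sub (Nat.lt_succ_iff.1 (Finset.mem_range.1 hm))]
    rw [Finset.sum_congr rfl hsplit, Finset.sum_add_distrib, ih]
    simp only [Nat.sub_self, zero_add, Finset.sum_range_one] at hlast ⊢
    linarith

theorem facMoment_genMatch (k n : ℕ) (lam : ℝ) :
    facMoment k (genMatch n lam) = if k ≤ n then lam ^ k else 0 := by
  split_ifs with hk
  · obtain ⟨N, rfl⟩ := Nat.exists_eq_add_of_le' hk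
    rw [facMoment_eq_tsum_add, tsum_eq_sum (s := Finset.range (N + 1))]
    · rw [← mul_one (lam ^ k), ← sum_range_pow_div_factorial_mul_sum_neg lam N, Finset.mul_sum]
      refine Finset.sum_congr rfl fun m hm => ?_
      have hmN : m ≤ N := Nat.lt_succ_iff.1 (Finset.mem_range.1 hm)
      rw [genMatch, if_pos (Nat.add_le_add_right hmN k), Nat.add_sub_add_right]
      calc _ = lam ^ (m + k) * (descFac (m + k) k / ((m + k).factorial : ℝ)) *
            ∑ i ∈ Finset.range (N - m + 1), (-lam) ^ i / (i.factorial : ℝ) := by ring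
        _ = _ := by rw [descFac_add_div_factorial]; ring
    · intro m hm
      rw [Finset.mem_range] at hm
      rw [genMatch, if_neg (by omega), mul_zero]
  · refine (tsum_congr fun j => ?_).trans tsum_zero
    rcases lt_or_ge j k with hj | hj
    · rw [descFac_of_lt hj, zero_mul]
    · rw [genMatch, if_neg (by omega), mul_zero]

theorem summable_pow_add_div_factorial (x : ℝ) (n : ℕ) :
    Summable fun k : ℕ => x ^ (n + k) / ((n + k).factorial : ℝ) := by
  simpa only [add_comm n] using
    (summable_nat_add_iff n).2 (Real.summable_pow_div_factorial x)

theorem dFM_genMatch_poissonPmf {α lam : ℝ} (hα : 0 < α) (hlam : 0 ≤ lam) (n : ℕ) :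
    dFM α (genMatch n lam) (poissonPmf lam) = ENNReal.ofReal
      ((1 / α) * ∑' k : ℕ, (α * lam) ^ (n + 1 + k) / ((n + 1 + k).factorial : ℝ)) := by
  rw [← tsum_mul_left, ENNReal.ofReal_tsum_of_nonneg (fun k => by positivity)
    ((summable_pow_add_div_factorial _ _).mul_left _), dFM,
    tsum_eq_tsum_add_of_lt_eq_zero n fun j hj => ?_]
  · refine tsum_congr fun k => congrArg ENNReal.ofReal ?_
    rw [facMoment_genMatch, facMoment_poissonPmf, if_neg (by omega), zero_sub, abs_neg,
      abs_of_nonneg (by positivity), show n + 1 + k = k + n + 1 by ring]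
    field_simp
    ring
  · rw [facMoment_genMatch, facMoment_poissonPmf, if_pos (by omega)]
    simp

theorem mul_integral_one_sub_pow_succ_mul_exp (x : ℝ) (n : ℕ) :
    x * ∫ y in (0 : ℝ)..1, (1 - y) ^ (n + 1) * Real.exp (x * y) =
      (n + 1) * (∫ y in (0 : ℝ)..1, (1 - y) ^ n * Real.exp (x * y)) - 1 := by
  have hderiv (y : ℝ) : HasDerivAt (fun y : ℝ => (1 - y) ^ (n + 1) * Real.exp (x * y))
      (x * ((1 - y) ^ (n + 1) * Real.exp (x * y)) -
        (n + 1) * ((1 - y) ^ n * Real.exp (x * y))) y := by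
    have h := (((hasDerivAt_id y).const_sub 1).pow (n + 1)).mul
      ((hasDerivAt_id y).const_mul x).exp
    refine h.congr_deriv ?_
    simp
    ring
  have h := intervalIntegral.integral_eq_sub_of_hasDerivAt (a := 0) (b := 1)
    (fun y _ => hderiv y) (Continuous.intervalIntegrable (by fun_prop) _ _)
  rw [intervalIntegral.integral_sub (Continuous.intervalIntegrable (by fun_prop) _ _)
    (Continuous.intervalIntegrable (by fun_prop) _ _), intervalIntegral.integral_const_mul,
    intervalIntegral.integral_const_mul] at h
  simp at h
  linarith

/-- The integral form of the Taylor remainder of the exponential. -/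
theorem tsum_pow_div_factorial_eq_integral (x : ℝ) (n : ℕ) :
    ∑' k : ℕ, x ^ (n + 1 + k) / ((n + 1 + k).factorial : ℝ) =
      x ^ (n + 1) / (n.factorial : ℝ) *
        ∫ y in (0 : ℝ)..1, (1 - y) ^ n * Real.exp (x * y) := by
  have hstep (n : ℕ) : ∑' k : ℕ, x ^ (n + k) / ((n + k).factorial : ℝ) =
      x ^ n / (n.factorial : ℝ) +
        ∑' k : ℕ, x ^ (n + 1 + k) / ((n + 1 + k).factorial : ℝ) := by
    rw [(summable_pow_add_div_factorial x n).tsum_eq_zero_add]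
    simp only [add_zero, add_assoc, add_comm 1]
  induction n with
  | zero =>
    have hexp : ∑' k : ℕ, x ^ k / (k.factorial : ℝ) = Real.exp x := by
      rw [Real.exp_eq_exp_ℝ, NormedSpace.exp_eq_tsum_div]
    have h0 := hstep 0
    have hint : x * ∫ y in (0 : ℝ)..1, Real.exp (x * y) = Real.exp x - 1 := by
      rw [intervalIntegral.mul_integral_comp_mul_left (f := Real.exp)]
      simp
    simp only [zero_add, pow_zero, Nat.factorial_zero, Nat.cast_one, div_one, one_mul, pow_one,
      hexp] at h0 ⊢
    linarith
  | succ n ih =>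
    have h := hstep (n + 1)
    have hI := mul_integral_one_sub_pow_succ_mul_exp x n
    rw [ih] at h
    rw [pow_succ x (n + 1), mul_div_right_comm, mul_assoc, hI, ← sub_eq_iff_eq_add'.2 h,
      Nat.factorial_succ]
    generalize ∫ y in (0 : ℝ)..1, (1 - y) ^ n * Real.exp (x * y) = I
    push_cast
    field_simp

theorem stmt13 (α : ℝ) (hα : 0 < α) (lam : ℝ) (hlam : 0 < lam ∧ lam ≤ 1) (n : ℕ) :
    dFM α (genMatch n lam) (poissonPmf lam)
        = ENNReal.ofReal
            ((1 / α) * ∑' k : ℕ, (α * lam) ^ (n + 1 + k) / (Nat.factorial (n + 1 + k) : ℝ)) ∧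
    dFM α (genMatch n lam) (poissonPmf lam)
        = ENNReal.ofReal
            (α ^ n * lam ^ (n + 1) / (Nat.factorial n : ℝ)
              * ∫ y in (0 : ℝ)..1, (1 - y) ^ n * Real.exp (α * lam * y)) := by
  have h := dFM_genMatch_poissonPmf hα hlam.1.le n
  refine ⟨h, h.trans (congrArg ENNReal.ofReal ?_)⟩
  rw [tsum_pow_div_factorial_eq_integral, mul_pow]
  generalize ∫ y in (0 : ℝ)..1, (1 - y) ^ n * Real.exp (α * lam * y) = I
  field_simp
  ring
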